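/- Every sort of ordinal functional in which all product constructors are indexed by nonempty sets is well-founded under the relation <; that is, there is no infinite sequence f₀ > f₁ > f₂ > ⋯ of elements of such a sort. -/

import Mathlib

namespace PMP

/-- Sorts of ordinal functionals: `ord` is the sort of ordinals, `fn θ θ'` the sort of
functions from sort `θ` to sort `θ'`, and `prod I f` the product of the sorts `f i` over
the index set `I`. -/
inductive OSort : Type 1 where
  | ord : OSort
  | fn : OSort → OSort → OSort
  | prod : (I : Type) → (I → OSort) → OSort

/-- The interpretation of a sort, together with the relation `<` on it, defined by
simultaneous recursion: on `ord` the interpretation is the ordinals with the usual order;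
on `fn θ θ'` it is the full function space, with `f < g` iff there is an `a` of sort `θ`
such that `f b < g b` for every `b` of sort `θ` with `a < b`; on a product it is the
product type, with the pointwise (everywhere) comparison. -/
noncomputable def OSort.data : OSort → (T : Type 1) × (T → T → Prop)
  | .ord => ⟨Ordinal, fun a b => a < b⟩
  | .fn θ θ' => ⟨θ.data.1 → θ'.data.1,
      fun f g => ∃ a : θ.data.1, ∀ b : θ.data.1, θ.data.2 a b → θ'.data.2 (f b) (g b)⟩
  | .prod I f => ⟨(i : I) → (f i).data.1, fun x y => ∀ i : I, (f i).data.2 (x i) (y i)⟩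

/-- The interpretation (carrier) of a sort. -/
noncomputable def OSort.interp (θ : OSort) : Type 1 := θ.data.1

/-- The order `<` on (the interpretation of) a sort. -/
noncomputable def OSort.lt (θ : OSort) : θ.interp → θ.interp → Prop := θ.data.2

/-- A sort in which all product constructors are indexed by nonempty sets. -/
def OSort.good : OSort → Prop
  | .ord => True
  | .fn θ θ' => θ.good ∧ θ'.good
  | .prod I f => Nonempty I ∧ ∀ i : I, (f i).good

theorem OSort.data_nonempty (θ : OSort) : Nonempty θ.data.1 := by
  induction θ with
  | ord => exact ⟨(0 : Ordinal)⟩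
  | fn θ θ' _ ih => exact ⟨fun _ => ih.some⟩
  | prod I f ih => exact ⟨fun i => (ih i).some⟩

theorem OSort.data_bound (θ : OSort) (F : ℕ → θ.data.1) :
    ∃ b : θ.data.1, ∀ n, θ.data.2 (F n) b := by
  induction θ with
  | ord =>
    let G : ℕ → Ordinal.{0} := F
    have key : ∃ b : Ordinal.{0}, ∀ n, G n < b :=
      ⟨Order.succ (⨆ n, G n), fun n =>
        Order.lt_succ_of_le (le_ciSup (Ordinal.bddAbove_of_small (s := Set.range G)) n)⟩
    exact key
  | fn θ θ' _ ih =>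
    choose g hg using fun x : θ.data.1 => ih (fun n => F n x)
    exact ⟨g, fun n => ⟨(OSort.data_nonempty θ).some, fun b _ => hg b n⟩⟩
  | prod I f ih =>
    choose g hg using fun i : I => ih i (fun n => F n i)
    exact ⟨g, fun n i => hg i n⟩

theorem OSort.data_wf (θ : OSort) (hθ : θ.good) (F : ℕ → θ.data.1)
    (h : ∀ n : ℕ, θ.data.2 (F (n + 1)) (F n)) : False := by
  induction θ with
  | ord =>
    let G : ℕ → Ordinal.{0} := F
    have hG : ∀ n, G (n + 1) < G n := h
    exact (RelEmbedding.natGT (r := (· < ·)) G hG).not_wellFounded wellFounded_lt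
  | fn θ θ' _ ih =>
    have h' : ∀ n : ℕ, ∃ a : θ.data.1, ∀ b : θ.data.1, θ.data.2 a b →
      θ'.data.2 (F (n + 1) b) (F n b) := h
    choose a ha using h'
    obtain ⟨b, hb⟩ := OSort.data_bound θ a
    exact ih hθ.2 (fun n => F n b) (fun n => ha n b (hb n))
  | prod I f ih =>
    obtain ⟨⟨i⟩, hf⟩ := hθ
    exact ih i (hf i) (fun n => F n i) (fun n => h n i)

/-- Every sort of ordinal functional whose product constructors are all indexed by
nonempty sets is well-founded under `<`: there is no infinite strictly decreasing
sequence `f₀ > f₁ > f₂ > ⋯`. -/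
theorem sorts_are_wellfounded (θ : OSort) (hθ : θ.good) :
    ¬ ∃ F : ℕ → θ.interp, ∀ n : ℕ, θ.lt (F (n + 1)) (F n) := by
  rintro ⟨F, h⟩
  exact OSort.data_wf θ hθ F h

end PMP
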